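/- Let β > 1 and set C'_β = ((3+β)/2)·Σ_{i=0}^∞ (2i+1)·β^{-i}. For every k ≥ 1 and every order-k branch of the fractal configuration ξ with root r, the β-biased random walk on ξ that takes a step from r into the branch (i.e., is started at the abutment vertex adjacent to r) returns to r in expected time at most 3·2^k + C'_β; that is, 1 plus the expected hitting time of r for the walk started at the abutment vertex adjacent to r is at most 3·2^k + C'_β. -/

import Mathlib

open MeasureTheory Filter
open scoped ENNReal

noncomputable section

/-- Vertices of the square lattice. -/
abbrev V : Type := ℤ × ℤ

/-- Adjacency in the square lattice ℤ²: Euclidean distance one. -/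
def latAdj (u v : V) : Prop := (u.1 - v.1) ^ 2 + (u.2 - v.2) ^ 2 = 1

instance : MeasurableSpace (Sym2 V) := ⊤

open scoped Classical in
/-- One-step transition probability of the β-biased random walk on the subgraph of ℤ²
with edge set `G`: if the set `Λ` of neighbours of `z` is nonempty and contains the right
neighbour `(z.1+1, z.2)`, step to it with probability `β/(β+|Λ|-1)` and to each other
neighbour with probability `1/(β+|Λ|-1)`; if `Λ` does not contain the right neighbour, step
uniformly in `Λ`; if `Λ` is empty, stay put. -/
def transProb (β : ℝ) (G : Set (Sym2 V)) (z w : V) : ℝ :=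
  if {u : V | s(z, u) ∈ G} = ∅ then (if w = z then 1 else 0)
  else
    if s(z, w) ∈ G then
      (if s(z, ((z.1 + 1, z.2) : V)) ∈ G then
        (if w = ((z.1 + 1, z.2) : V) then
          β / (β + ({u : V | s(z, u) ∈ G}.ncard : ℝ) - 1)
        else 1 / (β + ({u : V | s(z, u) ∈ G}.ncard : ℝ) - 1))
      else 1 / ({u : V | s(z, u) ∈ G}.ncard : ℝ))
    else 0

/-- `μ` is the law of the β-biased random walk on the subgraph of ℤ² with edge set `G`,
started at `z₀`: a probability measure on trajectories whose cylinder probabilities are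
the products of the one-step transition probabilities. -/
def IsWalkLaw (β : ℝ) (G : Set (Sym2 V)) (z₀ : V) (μ : Measure (ℕ → V)) : Prop :=
  IsProbabilityMeasure μ ∧
    ∀ (n : ℕ) (f : ℕ → V), f 0 = z₀ →
      μ {ω | ∀ i ≤ n, ω i = f i} =
        ENNReal.ofReal (∏ i ∈ Finset.range n, transProb β G (f i) (f (i + 1)))

/-- `b_k = 4 · 3^{k(k-1)/2}`. -/
def bF (k : ℕ) : ℕ := 4 * 3 ^ (k * (k - 1) / 2)

/-- `q_k = 3^k - 1`. -/
def qF (k : ℕ) : ℕ := 3 ^ k - 1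

open scoped Classical in
/-- Direction of the abutment of a branch on row index `l` (odd): `+1` if `(l+1)/2` is odd
(so that the root lands on a row reserved for branches of the next order), `-1` otherwise. -/
def dirF (l : ℤ) : ℤ := if Odd ((l + 1) / 2) then 1 else -1

/-- The set of x-coordinates of tips of order-`k` branches of the fractal configuration:
`0` is a tip of every order, and if `x` is an order-`(k+1)` tip then `x + (j-1)·b_k` is an
order-`k` tip for every `1 ≤ j ≤ q_k` (the order-`k` branches attached to the order-`(k+1)`
branch with tip `x` have their roots at `x + j·b_k - 1`, hence their tips at `x + (j-1)·b_k`). -/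
inductive IsTip : ℕ → ℤ → Prop
  | zero (k : ℕ) : IsTip k 0
  | step (k : ℕ) (x : ℤ) (j : ℕ) : IsTip (k + 1) x → 1 ≤ j → j ≤ qF k →
      IsTip k (x + ((j : ℤ) - 1) * (bF k : ℤ))

/-- The y-coordinate of the row with index `l` reserved for order-`k` branches:
`y = 3 · 2^{k-1} · l` (`l` odd). -/
def rowY (k : ℕ) (l : ℤ) : ℤ := 3 * 2 ^ (k - 1) * l

/-- The fractal configuration ξ: for every order `k ≥ 1`, every odd `l` and every order-`k`
tip `x`, the main part of the branch (the `b_k - 1` horizontal edges from the tip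
`(x, 3·2^{k-1}·l)` to the corner `(x + b_k - 1, 3·2^{k-1}·l)`) together with its abutment
(the `3·2^{k-1}` vertical edges from the corner to the root, in the direction `dirF l`). -/
def xiEdges : Set (Sym2 V) :=
  {f | ∃ (k : ℕ) (l x : ℤ), 1 ≤ k ∧ Odd l ∧ IsTip k x ∧
    ((∃ i : ℕ, i + 2 ≤ bF k ∧
        f = s((x + i, rowY k l), (x + i + 1, rowY k l))) ∨
      (∃ j : ℕ, j < 3 * 2 ^ (k - 1) ∧
        f = s((x + bF k - 1, rowY k l + dirF l * j),
              (x + bF k - 1, rowY k l + dirF l * (j + 1)))))}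

/-- `z` lies on the main part of the order-`k` branch with row index `l` and tip
x-coordinate `x`. -/
def OnMainPart (k : ℕ) (l x : ℤ) (z : V) : Prop :=
  z.2 = rowY k l ∧ x ≤ z.1 ∧ z.1 ≤ x + bF k - 1

/-- First hitting time of the vertex `a` (with value `⊤` if `a` is never visited). -/
def hitTime (ω : ℕ → V) (a : V) : ℕ∞ :=
  sInf {n : ℕ∞ | ∃ t : ℕ, (t : ℕ∞) = n ∧ ω t = a}

/-- The constant `C'_β = ((3+β)/2) · Σ_{i≥0} (2i+1) β^{-i}`. -/
def Cprime (β : ℝ) : ℝ := ((3 + β) / 2) * ∑' i : ℕ, (2 * (i : ℝ) + 1) * (1 / β) ^ i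

section TruncatedHittingTime

variable {α : Type*} [DecidableEq α] (p : α → α → ℝ) (N : α → Finset α)

/-- Expectation of the hitting time of `a` truncated at `n`, for the chain with transition
probabilities `p v w`, `w ∈ N v`. -/
def truncHit (a : α) : ℕ → α → ℝ
  | 0, _ => 0
  | n + 1, v => if v = a then 0 else 1 + ∑ w ∈ N v, p v w * truncHit a n w

/-- Probability that the chain started at `v` avoids `a` up to time `t`. -/
def survival (a : α) : ℕ → α → ℝ
  | 0, v => if v = a then 0 else 1
  | t + 1, v => if v = a then 0 else ∑ w ∈ N v, p v w * survival a t w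

/-- The hitting time of `a` from `v` has expectation at most `c`. -/
def HitLE (a v : α) (c : ℝ) : Prop := ∀ n, truncHit p N a n v ≤ c

/-- `p` is nonnegative with row sums at most one over `N`. -/
structure IsSubKernel : Prop where
  nonneg : ∀ v w, 0 ≤ p v w
  sum_le : ∀ v, ∑ w ∈ N v, p v w ≤ 1

variable {p N}

theorem survival_nonneg (hp : IsSubKernel p N) (a : α) (t : ℕ) (v : α) :
    0 ≤ survival p N a t v := by
  induction t generalizing v with
  | zero => simp only [survival]; split_ifs <;> norm_num
  | succ t ih =>
    simp only [survival]
    split_ifs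
    · exact le_rfl
    · exact Finset.sum_nonneg fun w _ => mul_nonneg (hp.nonneg v w) (ih w)

theorem sum_survival (a : α) (n : ℕ) (v : α) :
    ∑ t ∈ Finset.range n, survival p N a t v = truncHit p N a n v := by
  induction n generalizing v with
  | zero => simp [truncHit]
  | succ n ih =>
    rw [Finset.sum_range_succ']
    simp only [survival, truncHit]
    split_ifs
    · simp
    · rw [Finset.sum_comm, add_comm]
      simp_rw [← Finset.mul_sum, ih]

theorem truncHit_self (a : α) (n : ℕ) : truncHit p N a n a = 0 := by
  cases n <;> simp [truncHit]

theorem truncHit_nonneg (hp : IsSubKernel p N) (a : α) (n : ℕ) (v : α) :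
    0 ≤ truncHit p N a n v := by
  rw [← sum_survival]
  exact Finset.sum_nonneg fun t _ => survival_nonneg hp a t v

theorem truncHit_le_succ (hp : IsSubKernel p N) (a : α) (n : ℕ) (v : α) :
    truncHit p N a n v ≤ truncHit p N a (n + 1) v := by
  rw [← sum_survival, ← sum_survival, Finset.sum_range_succ]
  linarith [survival_nonneg hp a n v]

theorem truncHit_triangle (hp : IsSubKernel p N) (a r : α) (n : ℕ) (v : α) :
    truncHit p N r n v ≤ truncHit p N a n v + truncHit p N r n a := by
  induction n generalizing v with
  | zero => simp [truncHit]
  | succ n ih =>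
    by_cases hva : v = a
    · subst hva; rw [truncHit_self]; simp
    by_cases hvr : v = r
    · subst hvr
      rw [truncHit_self]
      exact add_nonneg (truncHit_nonneg hp _ _ _) (truncHit_nonneg hp _ _ _)
    · have h0 := truncHit_nonneg hp r n a
      have h1 : ∑ w ∈ N v, p v w * truncHit p N r n w ≤
          ∑ w ∈ N v, p v w * truncHit p N a n w + truncHit p N r n a := by
        calc _ ≤ ∑ w ∈ N v, (p v w * truncHit p N a n w + p v w * truncHit p N r n a) := by
              refine Finset.sum_le_sum fun w _ => ?_
              rw [← mul_add]
              exact mul_le_mul_of_nonneg_left (ih w) (hp.nonneg v w)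
          _ = ∑ w ∈ N v, p v w * truncHit p N a n w +
              (∑ w ∈ N v, p v w) * truncHit p N r n a := by
              rw [Finset.sum_add_distrib, Finset.sum_mul]
          _ ≤ _ := by
              gcongr
              exact mul_le_of_le_one_left h0 (hp.sum_le v)
      have h2 := truncHit_le_succ hp r n a
      have e1 : truncHit p N r (n + 1) v = 1 + ∑ w ∈ N v, p v w * truncHit p N r n w := by
        simp [truncHit, hvr]
      have e2 : truncHit p N a (n + 1) v = 1 + ∑ w ∈ N v, p v w * truncHit p N a n w := by
        simp [truncHit, hva]
      linarith

theorem HitLE.nonneg {a v : α} {c : ℝ} (h : HitLE p N a v c) : 0 ≤ c := by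
  simpa [truncHit] using h 0

theorem HitLE.mono {a v : α} {c d : ℝ} (h : HitLE p N a v c) (hcd : c ≤ d) :
    HitLE p N a v d := fun n => (h n).trans hcd

theorem HitLE.of_step (hp : IsSubKernel p N) {r v : α} {C : ℝ} (d : α → ℝ) (hC : 0 ≤ C)
    (hd : ∀ w ∈ N v, p v w ≠ 0 → w ≠ r → HitLE p N v w (d w))
    (h : 1 + ∑ w ∈ N v, p v w * (if w = r then 0 else d w + C) ≤ C) : HitLE p N r v C := by
  intro n
  induction n with
  | zero => simpa [truncHit] using hC
  | succ n ih =>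
    simp only [truncHit]
    split_ifs with hv
    · exact hC
    refine le_trans ?_ h
    gcongr 1 + ?_
    refine Finset.sum_le_sum fun w hw => ?_
    by_cases hpw : p v w = 0
    · simp [hpw]
    refine mul_le_mul_of_nonneg_left ?_ (hp.nonneg v w)
    split_ifs with hwr
    · rw [hwr, truncHit_self]
    · exact (truncHit_triangle hp v r n w).trans (add_le_add (hd w hw hpw hwr n) ih)

end TruncatedHittingTime

theorem hitTime_le_tsum (ω : ℕ → V) (a : V) :
    (hitTime ω a : ℝ≥0∞) ≤
      ∑' t : ℕ, Set.indicator {ω : ℕ → V | ∀ i ≤ t, ω i ≠ a} (1 : (ℕ → V) → ℝ≥0∞) ω := by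
  by_cases h : ∃ t, ω t = a
  · classical
    have h1 : hitTime ω a ≤ (Nat.find h : ℕ∞) := sInf_le ⟨_, rfl, Nat.find_spec h⟩
    calc (hitTime ω a : ℝ≥0∞) ≤ ((Nat.find h : ℕ∞) : ℝ≥0∞) := by exact_mod_cast h1
      _ = ∑ t ∈ Finset.range (Nat.find h),
          Set.indicator {ω : ℕ → V | ∀ i ≤ t, ω i ≠ a} (1 : (ℕ → V) → ℝ≥0∞) ω := by
        rw [Finset.sum_congr rfl (g := fun _ => (1 : ℝ≥0∞))]
        · simp
        · intro t ht
          rw [Set.indicator_of_mem]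
          · rfl
          · intro i hi
            exact Nat.find_min h (lt_of_le_of_lt hi (Finset.mem_range.1 ht))
      _ ≤ _ := ENNReal.sum_le_tsum _
  · push Not at h
    have : ∀ t : ℕ, Set.indicator {ω : ℕ → V | ∀ i ≤ t, ω i ≠ a}
        (1 : (ℕ → V) → ℝ≥0∞) ω = 1 := fun t => by
      rw [Set.indicator_of_mem]
      · rfl
      · exact fun i _ => h i
    simp [this]

theorem measure_prefix_avoid_le {β : ℝ} {G : Set (Sym2 V)} {z₀ : V} {μ : Measure (ℕ → V)}
    (hμ : IsWalkLaw β G z₀ μ) {N : V → Finset V} (hp : IsSubKernel (transProb β G) N)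
    (hN : ∀ v, ∀ w ∉ N v, transProb β G v w = 0) (a : V) (t m : ℕ) (f : ℕ → V)
    (hf : f 0 = z₀) :
    μ {ω | (∀ i ≤ m, ω i = f i) ∧ ∀ i ≤ t, ω (m + i) ≠ a} ≤
      ENNReal.ofReal ((∏ i ∈ Finset.range m, transProb β G (f i) (f (i + 1))) *
        survival (transProb β G) N a t (f m)) := by
  induction t generalizing m f with
  | zero =>
    by_cases hm : f m = a
    · have : {ω : ℕ → V | (∀ i ≤ m, ω i = f i) ∧ ∀ i ≤ 0, ω (m + i) ≠ a} = ∅ := by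
        ext ω
        simp only [Set.mem_ofPred_eq, Set.mem_empty_iff_false, iff_false, not_and]
        intro h1 h2
        exact h2 0 le_rfl (by simpa [hm] using h1 m le_rfl)
      rw [this]; simp
    · simp only [survival, hm, if_false, mul_one]
      rw [← hμ.2 m f hf]
      exact measure_mono fun ω h => h.1
  | succ t ih =>
    by_cases hm : f m = a
    · have : {ω : ℕ → V | (∀ i ≤ m, ω i = f i) ∧ ∀ i ≤ t + 1, ω (m + i) ≠ a} = ∅ := by
        ext ω
        simp only [Set.mem_ofPred_eq, Set.mem_empty_iff_false, iff_false, not_and]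
        intro h1 h2
        exact h2 0 (by omega) (by simpa [hm] using h1 m le_rfl)
      rw [this]; simp
    · have hsub : {ω : ℕ → V | (∀ i ≤ m, ω i = f i) ∧ ∀ i ≤ t + 1, ω (m + i) ≠ a} ⊆
          ⋃ w : V, {ω | (∀ i ≤ m + 1, ω i = Function.update f (m + 1) w i) ∧
            ∀ i ≤ t, ω (m + 1 + i) ≠ a} := by
        rintro ω ⟨h1, h2⟩
        refine Set.mem_iUnion.2 ⟨ω (m + 1), fun i hi => ?_, fun i hi => ?_⟩
        · rcases Nat.lt_or_ge m i with h | h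
          · obtain rfl : i = m + 1 := by omega
            simp
          · rw [Function.update_of_ne (by omega)]
            exact h1 i h
        · have := h2 (1 + i) (by omega)
          rwa [← add_assoc] at this
      have hprod : ∀ w : V, ∏ i ∈ Finset.range (m + 1),
          transProb β G (Function.update f (m + 1) w i) (Function.update f (m + 1) w (i + 1)) =
          (∏ i ∈ Finset.range m, transProb β G (f i) (f (i + 1))) * transProb β G (f m) w := by
        intro w
        rw [Finset.prod_range_succ]
        congr 1
        · refine Finset.prod_congr rfl fun i hi => ?_
          have := Finset.mem_range.1 hi
          rw [Function.update_of_ne (by omega), Function.update_of_ne (by omega)]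
        · rw [Function.update_of_ne (by omega)]
          simp
      have hP : 0 ≤ ∏ i ∈ Finset.range m, transProb β G (f i) (f (i + 1)) :=
        Finset.prod_nonneg fun i _ => hp.nonneg _ _
      calc _ ≤ ∑' w : V, μ {ω | (∀ i ≤ m + 1, ω i = Function.update f (m + 1) w i) ∧
            ∀ i ≤ t, ω (m + 1 + i) ≠ a} := (measure_mono hsub).trans (measure_iUnion_le _)
        _ ≤ ∑' w : V, ENNReal.ofReal ((∏ i ∈ Finset.range m, transProb β G (f i) (f (i + 1))) *
            (transProb β G (f m) w * survival (transProb β G) N a t w)) := by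
          refine ENNReal.tsum_le_tsum fun w => ?_
          refine (ih (m + 1) (Function.update f (m + 1) w) ?_).trans_eq ?_
          · rw [Function.update_of_ne (by omega)]; exact hf
          · rw [hprod, Function.update_self, mul_assoc]
        _ = ∑ w ∈ N (f m), ENNReal.ofReal
            ((∏ i ∈ Finset.range m, transProb β G (f i) (f (i + 1))) *
            (transProb β G (f m) w * survival (transProb β G) N a t w)) := by
          refine tsum_eq_sum fun w hw => ?_
          simp [hN _ _ hw]
        _ = _ := by
          rw [← ENNReal.ofReal_sum_of_nonneg, ← Finset.mul_sum]
          · simp only [survival, hm, if_false]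
          · exact fun w _ => mul_nonneg hP
              (mul_nonneg (hp.nonneg _ _) (survival_nonneg hp a t w))

theorem lintegral_hitTime_le {β : ℝ} {G : Set (Sym2 V)} {z₀ : V} {μ : Measure (ℕ → V)}
    (hμ : IsWalkLaw β G z₀ μ) {N : V → Finset V} (hp : IsSubKernel (transProb β G) N)
    (hN : ∀ v, ∀ w ∉ N v, transProb β G v w = 0) {a : V} {c : ℝ}
    (h : HitLE (transProb β G) N a z₀ c) :
    ∫⁻ ω, (hitTime ω a : ℝ≥0∞) ∂μ ≤ ENNReal.ofReal c := by
  have hmeas : ∀ t : ℕ, MeasurableSet {ω : ℕ → V | ∀ i ≤ t, ω i ≠ a} := by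
    intro t
    have : {ω : ℕ → V | ∀ i ≤ t, ω i ≠ a} =
        ⋂ i : ℕ, ⋂ _ : i ≤ t, (fun ω : ℕ → V => ω i) ⁻¹' {a}ᶜ := by
      ext ω; simp
    rw [this]
    exact MeasurableSet.iInter fun i => MeasurableSet.iInter fun _ =>
      measurable_pi_apply i (measurableSet_singleton a).compl
  calc _ ≤ ∫⁻ ω, ∑' t : ℕ, Set.indicator {ω : ℕ → V | ∀ i ≤ t, ω i ≠ a}
        (1 : (ℕ → V) → ℝ≥0∞) ω ∂μ := lintegral_mono fun ω => hitTime_le_tsum ω a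
    _ = ∑' t : ℕ, μ {ω : ℕ → V | ∀ i ≤ t, ω i ≠ a} := by
      rw [lintegral_tsum fun t => (measurable_one.indicator (hmeas t)).aemeasurable]
      simp_rw [lintegral_indicator_one (hmeas _)]
    _ ≤ ∑' t : ℕ, ENNReal.ofReal (survival (transProb β G) N a t z₀) := by
      refine ENNReal.tsum_le_tsum fun t => ?_
      have h1 := measure_prefix_avoid_le hμ hp hN a t 0 (fun _ => z₀) rfl
      have h2 : μ {ω : ℕ → V | ω 0 = z₀} = 1 := by
        have := hμ.2 0 (fun _ => z₀) rfl
        simpa using this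
      have := hμ.1
      have h3 : ∀ᵐ ω ∂μ, ω 0 = z₀ := by
        rw [ae_iff, ← Set.compl_ofPred, prob_compl_eq_zero_iff]
        · exact h2
        · have h0 : Measurable fun ω : ℕ → V => ω 0 := measurable_pi_apply 0
          exact h0 (measurableSet_singleton z₀)
      refine le_trans (measure_mono_ae ?_) (h1.trans_eq (by simp))
      filter_upwards [h3] with ω hω hav
      refine ⟨fun i hi => ?_, fun i hi => ?_⟩
      · obtain rfl : i = 0 := by omega
        exact hω
      · simpa using hav i hi
    _ ≤ ENNReal.ofReal c := by
      refine ENNReal.tsum_le_of_sum_range_le fun n => ?_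
      rw [← ENNReal.ofReal_sum_of_nonneg fun t _ => survival_nonneg hp a t z₀, sum_survival]
      exact ENNReal.ofReal_le_ofReal (h n)

/-- Weight of the edge from `v` to `w` relative to the other edges at `v`. -/
def stepWeight (β : ℝ) (v w : V) : ℝ := if w = (v.1 + 1, v.2) then β else 1

theorem stepWeight_pos {β : ℝ} (hβ : 0 < β) (v w : V) : 0 < stepWeight β v w := by
  unfold stepWeight; split_ifs <;> linarith

theorem transProb_eq (β : ℝ) {G : Set (Sym2 V)} {v : V} {F : Finset V}
    (hF : ∀ u, s(v, u) ∈ G ↔ u ∈ F) (hne : F.Nonempty) (w : V) :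
    transProb β G v w =
      if w ∈ F then stepWeight β v w / ∑ u ∈ F, stepWeight β v u else 0 := by
  have hset : {u : V | s(v, u) ∈ G} = (F : Set V) := by ext u; simp [hF]
  have hne' : ¬ ((F : Set V) = ∅) := by simpa using hne.ne_empty
  unfold transProb
  rw [hset, if_neg hne', Set.ncard_coe_finset]
  simp only [hF]
  by_cases hw : w ∈ F
  · simp only [hw, if_true]
    by_cases hr : ((v.1 + 1, v.2) : V) ∈ F
    · have hsum : ∑ u ∈ F, stepWeight β v u = β + (F.card : ℝ) - 1 := by
        have : ∀ u ∈ F, stepWeight β v u = 1 + if u = (v.1 + 1, v.2) then β - 1 else 0 := by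
          intro u _
          unfold stepWeight
          split_ifs <;> ring
        rw [Finset.sum_congr rfl this, Finset.sum_add_distrib, Finset.sum_ite_eq' F]
        simp only [hr, if_true, Finset.sum_const, nsmul_eq_mul, mul_one]
        ring
      rw [hsum]
      simp only [hr, if_true, stepWeight]
      split_ifs <;> rfl
    · have hone : ∀ u ∈ F, stepWeight β v u = 1 := by
        intro u hu
        unfold stepWeight
        rw [if_neg]
        rintro rfl
        exact hr hu
      rw [Finset.sum_congr rfl hone, hone w hw]
      simp [hr]
  · simp [hw]

/-- A vertex of the square lattice together with its four neighbours. -/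
def latticeStar (v : V) : Finset V :=
  {v, (v.1 + 1, v.2), (v.1 - 1, v.2), (v.1, v.2 + 1), (v.1, v.2 - 1)}

theorem transProb_eq_zero {β : ℝ} {G : Set (Sym2 V)} (hG : ∀ v u, s(v, u) ∈ G → u ∈ latticeStar v)
    (v w : V) (hw : w ∉ latticeStar v) : transProb β G v w = 0 := by
  have h1 : s(v, w) ∉ G := fun h => hw (hG v w h)
  have h2 : w ≠ v := by rintro rfl; exact hw (by simp [latticeStar])
  simp [transProb, h1, h2]

theorem isSubKernel_transProb {β : ℝ} (hβ : 1 < β) {G : Set (Sym2 V)}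
    (hG : ∀ v u, s(v, u) ∈ G → u ∈ latticeStar v) : IsSubKernel (transProb β G) latticeStar := by
  classical
  have key : ∀ v, (∀ w, transProb β G v w = if w = v then 1 else 0) ∨
      ∃ F ⊆ latticeStar v, F.Nonempty ∧ ∀ w, transProb β G v w =
        if w ∈ F then stepWeight β v w / ∑ u ∈ F, stepWeight β v u else 0 := by
    intro v
    set F := (latticeStar v).filter fun u => s(v, u) ∈ G with hFdef
    have hF : ∀ u, s(v, u) ∈ G ↔ u ∈ F := fun u => by
      simp only [hFdef, Finset.mem_filter]
      exact ⟨fun h => ⟨hG v u h, h⟩, fun h => h.2⟩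
    rcases F.eq_empty_or_nonempty with he | hne
    · left
      intro w
      have : {u : V | s(v, u) ∈ G} = ∅ := by ext u; simp [hF, he]
      simp [transProb, this]
    · exact Or.inr ⟨F, Finset.filter_subset _ _, hne, transProb_eq β hF hne⟩
  have hpos : ∀ v w, 0 < stepWeight β v w := stepWeight_pos (by linarith)
  constructor
  · intro v w
    rcases key v with h | ⟨F, _, _, h⟩
    · rw [h]; split_ifs <;> norm_num
    · rw [h]
      split_ifs
      · exact div_nonneg (hpos v w).le (Finset.sum_nonneg fun u _ => (hpos v u).le)
      · exact le_rfl
  · intro v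
    rcases key v with h | ⟨F, hsub, hne, h⟩
    · simp [h, latticeStar]
    · simp_rw [h]
      rw [← Finset.sum_filter, Finset.filter_mem_eq_inter, Finset.inter_eq_right.2 hsub,
        ← Finset.sum_div, div_self (Finset.sum_pos (fun u _ => hpos v u) hne).ne']

/-- One-step analysis of the walk at a vertex `v` with set of neighbours `F ∋ r`: here `d w` bounds
the expected time to come back to `v` from a neighbour `w ≠ r`. -/
theorem HitLE.of_neighbors {β : ℝ} (hβ : 1 < β) {G : Set (Sym2 V)}
    (hG : ∀ v u, s(v, u) ∈ G → u ∈ latticeStar v) {v r : V} {F : Finset V} {C : ℝ}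
    (hF : ∀ u, s(v, u) ∈ G ↔ u ∈ F) (hr : r ∈ F) (d : V → ℝ)
    (hd : ∀ w ∈ F, w ≠ r → HitLE (transProb β G) latticeStar v w (d w))
    (h : ∑ w ∈ F, stepWeight β v w + ∑ w ∈ F.erase r, stepWeight β v w * d w ≤
      C * stepWeight β v r) :
    HitLE (transProb β G) latticeStar r v C := by
  have hpos : ∀ v w, 0 < stepWeight β v w := stepWeight_pos (by linarith)
  have hS : 0 < ∑ w ∈ F, stepWeight β v w := Finset.sum_pos (fun u _ => hpos v u) ⟨r, hr⟩
  have hp := transProb_eq β hF ⟨r, hr⟩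
  have hd0 : 0 ≤ ∑ w ∈ F.erase r, stepWeight β v w * d w := Finset.sum_nonneg fun w hw =>
    mul_nonneg (hpos v w).le
      (hd w (Finset.mem_of_mem_erase hw) (Finset.ne_of_mem_erase hw)).nonneg
  have hC : 0 ≤ C := nonneg_of_mul_nonneg_left (by linarith) (hpos v r)
  refine HitLE.of_step (isSubKernel_transProb hβ hG) d hC ?_ ?_
  · intro w _ hw hwr
    refine hd w ?_ hwr
    by_contra hwF
    exact hw (by rw [hp, if_neg hwF])
  · have hsub : F ⊆ latticeStar v := fun u hu => hG v u ((hF u).2 hu)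
    simp_rw [hp, ite_mul, zero_mul]
    rw [← Finset.sum_filter, Finset.filter_mem_eq_inter, Finset.inter_eq_right.2 hsub,
      ← Finset.add_sum_erase F _ hr]
    simp only [if_true, mul_zero, zero_add]
    have e1 : ∑ w ∈ F.erase r, stepWeight β v w / (∑ u ∈ F, stepWeight β v u) *
          (if w = r then 0 else d w + C) =
        (∑ w ∈ F.erase r, stepWeight β v w * d w + (∑ w ∈ F.erase r, stepWeight β v w) * C) /
          ∑ u ∈ F, stepWeight β v u := by
      rw [Finset.sum_mul, ← Finset.sum_add_distrib, Finset.sum_div]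
      refine Finset.sum_congr rfl fun w hw => ?_
      rw [if_neg (Finset.ne_of_mem_erase hw)]
      ring
    have e2 := Finset.add_sum_erase F (stepWeight β v) hr
    rw [e1, ← sub_nonneg]
    have : C - (1 + (∑ w ∈ F.erase r, stepWeight β v w * d w +
        (∑ w ∈ F.erase r, stepWeight β v w) * C) / ∑ u ∈ F, stepWeight β v u) =
        (C * stepWeight β v r - (∑ w ∈ F, stepWeight β v w +
          ∑ w ∈ F.erase r, stepWeight β v w * d w)) / ∑ u ∈ F, stepWeight β v u := by
      field_simp
      rw [← e2]
      ring
    rw [this]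
    exact div_nonneg (by linarith) hS.le

theorem bF_succ (k : ℕ) : bF (k + 1) = 3 ^ k * bF k := by
  unfold bF
  rw [Nat.triangle_succ, pow_add]
  ring

theorem bF_dvd_bF {j k : ℕ} (h : j ≤ k) : bF j ∣ bF k := by
  induction k, h using Nat.le_induction with
  | base => exact dvd_rfl
  | succ k _ ih => exact ih.trans (by rw [bF_succ]; exact Dvd.intro_left _ rfl)

theorem four_dvd_bF (k : ℕ) : 4 ∣ bF k := Dvd.intro _ rfl

theorem bF_pos (k : ℕ) : 0 < bF k := by unfold bF; positivity

theorem four_le_bF (k : ℕ) : 4 ≤ bF k := Nat.le_of_dvd (bF_pos k) (four_dvd_bF k)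

theorem IsTip.dvd {k : ℕ} {x : ℤ} (h : IsTip k x) : (bF k : ℤ) ∣ x := by
  induction h with
  | zero => exact dvd_zero _
  | step k x j _ _ _ ih =>
    refine dvd_add (dvd_trans ?_ ih) (Dvd.intro_left _ rfl)
    exact_mod_cast bF_dvd_bF k.le_succ

/-- The column of the corner of a branch is not the column of a corner of a branch of
larger order. -/
theorem IsTip.not_dvd {k : ℕ} (hk : 1 ≤ k) {X : ℤ} (h : IsTip k (X - bF k)) :
    ¬ (bF (k + 1) : ℤ) ∣ X := by
  obtain ⟨z, hz⟩ : ∃ z, z = X - (bF k : ℤ) := ⟨_, rfl⟩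
  rw [← hz] at h
  have hb : (0 : ℤ) < bF k := by exact_mod_cast bF_pos k
  have h3 : (1 : ℤ) < 3 ^ k := one_lt_pow₀ (by norm_num) (by omega)
  have key : ∀ (x j : ℤ), (bF (k + 1) : ℤ) ∣ x → 1 ≤ j → j < 3 ^ k → X = x + j * bF k →
      ¬ (bF (k + 1) : ℤ) ∣ X := by
    intro x j hx h1 h2 hX hd
    rw [hX, Int.dvd_add_right hx, bF_succ, Nat.cast_mul] at hd
    have := Int.le_of_dvd (by omega) (Int.dvd_of_mul_dvd_mul_right hb.ne' hd)
    push_cast at this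
    omega
  cases h with
  | zero => exact key 0 1 (dvd_zero _) le_rfl h3 (by linarith)
  | step _ x j hx h1 h2 =>
    refine key x j hx.dvd (by exact_mod_cast h1) ?_ (by linarith)
    unfold qF at h2
    have : 0 < 3 ^ k := by positivity
    exact_mod_cast (show j < 3 ^ k by omega)

theorem IsTip.order_le {j k : ℕ} (hj : 1 ≤ j) {X : ℤ} (h : IsTip j (X - bF j))
    (hk : (bF k : ℤ) ∣ X) : k ≤ j := by
  by_contra! hlt
  exact h.not_dvd hj (dvd_trans (by exact_mod_cast bF_dvd_bF hlt) hk)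

theorem IsTip.corner_dvd {k : ℕ} {X : ℤ} (h : IsTip k (X - bF k)) : (bF k : ℤ) ∣ X :=
  (dvd_sub_left dvd_rfl).1 h.dvd

theorem IsTip.order_unique {j k : ℕ} (hj : 1 ≤ j) (hk : 1 ≤ k) {X : ℤ}
    (h : IsTip j (X - bF j)) (h' : IsTip k (X - bF k)) : j = k :=
  le_antisymm (h'.order_le hk h.corner_dvd) (h.order_le hj h'.corner_dvd)

theorem rowY_succ (m : ℕ) (l : ℤ) : rowY (m + 1) l = 3 * 2 ^ m * l := by simp [rowY]

theorem two_pow_mul_odd {m m' : ℕ} {l l' : ℤ} (hl : Odd l) (hl' : Odd l')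
    (h : 2 ^ m * l = 2 ^ m' * l') : m = m' := by
  wlog hlt : m ≤ m' generalizing m m' l l'
  · exact (this hl' hl h.symm (by omega)).symm
  obtain ⟨n, rfl⟩ := Nat.exists_eq_add_of_le hlt
  rw [pow_add, mul_assoc] at h
  have h2 : l = 2 ^ n * l' := mul_left_cancel₀ (by positivity) h
  rcases n.eq_zero_or_pos with h0 | h0
  · omega
  · exfalso
    rw [h2] at hl
    exact Int.not_even_iff_odd.2 hl
      (((even_two).pow_of_ne_zero h0.ne').mul_right _)

theorem rowY_injective {m m' : ℕ} {l l' : ℤ} (hl : Odd l) (hl' : Odd l')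
    (h : 3 * 2 ^ m * l = 3 * 2 ^ m' * l') : m = m' :=
  two_pow_mul_odd hl hl' (by linarith)

theorem dirF_four_mul_add_one (t : ℤ) : dirF (4 * t + 1) = 1 := by
  unfold dirF
  rw [show (4 * t + 1 + 1) / 2 = 2 * t + 1 by omega, if_pos ⟨t, rfl⟩]

theorem dirF_four_mul_add_three (t : ℤ) : dirF (4 * t + 3) = -1 := by
  unfold dirF
  rw [show (4 * t + 3 + 1) / 2 = 2 * t + 2 by omega, if_neg]
  rintro ⟨s, hs⟩
  omega

theorem odd_cases {l : ℤ} (hl : Odd l) : (∃ t, l = 4 * t + 1) ∨ ∃ t, l = 4 * t + 3 := by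
  obtain ⟨j, rfl⟩ := hl
  rcases Int.even_or_odd' j with ⟨t, rfl | rfl⟩
  · exact Or.inl ⟨t, by ring⟩
  · exact Or.inr ⟨t, by ring⟩

/-- The edge from `(X, Y)` to `(X + 1, Y)` lies on the main part of some branch. -/
def HasRight (X Y : ℤ) : Prop :=
  ∃ (m : ℕ) (l x : ℤ), Odd l ∧ IsTip (m + 1) x ∧ Y = 3 * 2 ^ m * l ∧ x ≤ X ∧
    X + 2 ≤ x + bF (m + 1)

/-- The edge from `(X, Y)` to `(X, Y + 1)` lies on the abutment of some branch; the abutments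
on rows `4 t + 1` and `4 t + 3` join at their common root. -/
def HasUp (X Y : ℤ) : Prop :=
  ∃ (m : ℕ) (t : ℤ), IsTip (m + 1) (X + 1 - bF (m + 1)) ∧ 3 * 2 ^ m * (4 * t + 1) ≤ Y ∧
    Y < 3 * 2 ^ m * (4 * t + 3)

theorem HasRight.mem {X Y : ℤ} (h : HasRight X Y) :
    s(((X, Y) : V), ((X + 1, Y) : V)) ∈ xiEdges := by
  obtain ⟨m, l, x, hl, hx, hY, h1, h2⟩ := h
  refine ⟨m + 1, l, x, by omega, hl, hx, Or.inl ⟨(X - x).toNat, by omega, ?_⟩⟩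
  have : ((X - x).toNat : ℤ) = X - x := Int.toNat_of_nonneg (by omega)
  rw [this, rowY_succ, ← hY]
  simp

theorem HasUp.mem {X Y : ℤ} (h : HasUp X Y) :
    s(((X, Y) : V), ((X, Y + 1) : V)) ∈ xiEdges := by
  obtain ⟨m, t, hx, h1, h2⟩ := h
  set u : ℤ := 3 * 2 ^ m with hu
  rcases lt_or_ge Y (u * (4 * t + 2)) with h3 | h3
  · have e : ((Y - u * (4 * t + 1)).toNat : ℤ) = Y - u * (4 * t + 1) :=
      Int.toNat_of_nonneg (by omega)
    refine ⟨m + 1, 4 * t + 1, _, by omega, ⟨2 * t, by ring⟩, hx,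
      Or.inr ⟨(Y - u * (4 * t + 1)).toNat, ?_, ?_⟩⟩
    · zify
      rw [e]
      simp only [Nat.add_sub_cancel, ← hu]
      linarith
    · rw [e, rowY_succ, dirF_four_mul_add_one, ← hu]
      exact congrArg₂ (fun a b : V => s(a, b)) (Prod.ext (by ring) (by ring))
        (Prod.ext (by ring) (by ring))
  · have e : ((u * (4 * t + 3) - Y - 1).toNat : ℤ) = u * (4 * t + 3) - Y - 1 :=
      Int.toNat_of_nonneg (by omega)
    refine ⟨m + 1, 4 * t + 3, _, by omega, ⟨2 * t + 1, by ring⟩, hx,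
      Or.inr ⟨(u * (4 * t + 3) - Y - 1).toNat, ?_, ?_⟩⟩
    · zify
      rw [e]
      simp only [Nat.add_sub_cancel, ← hu]
      linarith
    · rw [e, rowY_succ, dirF_four_mul_add_three, ← hu, Sym2.eq_swap]
      exact congrArg₂ (fun a b : V => s(a, b)) (Prod.ext (by ring) (by ring))
        (Prod.ext (by ring) (by ring))

theorem mem_xiEdges_cases {f : Sym2 V} (h : f ∈ xiEdges) :
    (∃ X Y, HasRight X Y ∧ f = s(((X, Y) : V), ((X + 1, Y) : V))) ∨
      ∃ X Y, HasUp X Y ∧ f = s(((X, Y) : V), ((X, Y + 1) : V)) := by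
  obtain ⟨k, l, x, hk, hl, hx, ⟨i, hi, rfl⟩ | ⟨j, hj, rfl⟩⟩ := h
  · obtain ⟨m, rfl⟩ := Nat.exists_eq_add_of_le' hk
    exact Or.inl ⟨_, _, ⟨m, l, x, hl, hx, rowY_succ m l, by omega, by omega⟩, rfl⟩
  · obtain ⟨m, rfl⟩ := Nat.exists_eq_add_of_le' hk
    right
    have htip : IsTip (m + 1) (x + bF (m + 1) - 1 + 1 - bF (m + 1)) := by
      simpa using hx
    simp only [Nat.add_sub_cancel] at hj
    have hj' : (j : ℤ) < 3 * 2 ^ m := by exact_mod_cast hj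
    have hj0 : (0 : ℤ) ≤ j := by positivity
    rcases odd_cases hl with ⟨t, rfl⟩ | ⟨t, rfl⟩
    · refine ⟨x + bF (m + 1) - 1, 3 * 2 ^ m * (4 * t + 1) + j, ⟨m, t, htip, ?_, ?_⟩, ?_⟩
      · linarith
      · linarith
      · rw [rowY_succ, dirF_four_mul_add_one]
        exact congrArg₂ (fun a b : V => s(a, b)) (Prod.ext (by ring) (by ring))
          (Prod.ext (by ring) (by ring))
    · refine ⟨x + bF (m + 1) - 1, 3 * 2 ^ m * (4 * t + 3) - j - 1, ⟨m, t, htip, ?_, ?_⟩, ?_⟩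
      · have := Int.add_one_le_of_lt hj'
        linarith
      · linarith
      · rw [rowY_succ, dirF_four_mul_add_three, Sym2.eq_swap]
        exact congrArg₂ (fun a b : V => s(a, b)) (Prod.ext (by ring) (by ring))
          (Prod.ext (by ring) (by ring))

theorem mem_xiEdges_iff (X Y : ℤ) (u : V) : s(((X, Y) : V), u) ∈ xiEdges ↔
    (u = (X + 1, Y) ∧ HasRight X Y) ∨ (u = (X - 1, Y) ∧ HasRight (X - 1) Y) ∨
      (u = (X, Y + 1) ∧ HasUp X Y) ∨ (u = (X, Y - 1) ∧ HasUp X (Y - 1)) := by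
  constructor
  · intro h
    rcases mem_xiEdges_cases h with ⟨X', Y', h', e⟩ | ⟨X', Y', h', e⟩
    · rcases Sym2.eq_iff.1 e with ⟨e1, e2⟩ | ⟨e1, e2⟩
      · obtain ⟨rfl, rfl⟩ := Prod.mk.inj e1
        exact Or.inl ⟨e2, h'⟩
      · obtain ⟨rfl, rfl⟩ := Prod.mk.inj e1
        exact Or.inr (Or.inl ⟨by simpa using e2, by simpa using h'⟩)
    · rcases Sym2.eq_iff.1 e with ⟨e1, e2⟩ | ⟨e1, e2⟩
      · obtain ⟨rfl, rfl⟩ := Prod.mk.inj e1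
        exact Or.inr (Or.inr (Or.inl ⟨e2, h'⟩))
      · obtain ⟨rfl, rfl⟩ := Prod.mk.inj e1
        exact Or.inr (Or.inr (Or.inr ⟨by simpa using e2, by simpa using h'⟩))
  · rintro (⟨rfl, h⟩ | ⟨rfl, h⟩ | ⟨rfl, h⟩ | ⟨rfl, h⟩)
    · exact h.mem
    · rw [Sym2.eq_swap]; simpa using h.mem
    · exact h.mem
    · rw [Sym2.eq_swap]; simpa using h.mem

theorem mem_latticeStar_of_mem_xiEdges (v u : V) (h : s(v, u) ∈ xiEdges) :
    u ∈ latticeStar v := by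
  rcases (mem_xiEdges_iff v.1 v.2 u).1 h with ⟨rfl, _⟩ | ⟨rfl, _⟩ | ⟨rfl, _⟩ | ⟨rfl, _⟩ <;>
    simp [latticeStar]

theorem eq_of_mem_block {d x x' X : ℤ} (hx : d ∣ x) (hx' : d ∣ x') (h1 : x ≤ X)
    (h2 : X < x + d) (h3 : x' ≤ X) (h4 : X < x' + d) : x' = x := by
  have := Int.eq_zero_of_abs_lt_dvd (dvd_sub hx' hx) (abs_lt.2 ⟨by omega, by omega⟩)
  omega

theorem hasRight_iff {m : ℕ} {l x X : ℤ} (hl : Odd l) (hx : IsTip (m + 1) x) (h1 : x ≤ X)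
    (h2 : X < x + bF (m + 1)) : HasRight X (3 * 2 ^ m * l) ↔ X + 2 ≤ x + bF (m + 1) := by
  constructor
  · rintro ⟨m', l', x', hl', hx', hY, h3, h4⟩
    obtain rfl := rowY_injective hl hl' hY
    obtain rfl := eq_of_mem_block hx.dvd hx'.dvd h1 h2 h3 (by omega)
    exact h4
  · exact fun h => ⟨m, l, x, hl, hx, rfl, h1, h⟩

theorem not_hasRight_tip {m : ℕ} {l x : ℤ} (hl : Odd l) (hx : IsTip (m + 1) x) :
    ¬ HasRight (x - 1) (3 * 2 ^ m * l) := by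
  rintro ⟨m', l', x', hl', hx', hY, h3, h4⟩
  obtain rfl := rowY_injective hl hl' hY
  have := bF_pos (m + 1)
  have := eq_of_mem_block hx.dvd hx'.dvd (le_refl x) (by omega) (by omega) (by omega)
  omega

theorem not_hasUp_tip {m : ℕ} {x : ℤ} (hx : IsTip (m + 1) x) (Y : ℤ) : ¬ HasUp x Y := by
  rintro ⟨m', t, hx', -⟩
  have h1 : (4 : ℤ) ∣ x := dvd_trans (by exact_mod_cast four_dvd_bF (m + 1)) hx.dvd
  have h2 : (4 : ℤ) ∣ x + 1 :=
    dvd_trans (by exact_mod_cast four_dvd_bF (m' + 1)) hx'.corner_dvd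
  omega

theorem neighbors_tip {m : ℕ} {l x : ℤ} (hl : Odd l) (hx : IsTip (m + 1) x) (u : V) :
    s(((x, 3 * 2 ^ m * l) : V), u) ∈ xiEdges ↔ u = (x + 1, 3 * 2 ^ m * l) := by
  have := four_le_bF (m + 1)
  have h1 : HasRight x (3 * 2 ^ m * l) := (hasRight_iff hl hx le_rfl (by omega)).2 (by omega)
  simp [mem_xiEdges_iff, h1, not_hasRight_tip hl hx, not_hasUp_tip hx]

/-- An abutment can meet the interior of the main part of a branch only at the root of a branch
of the previous order. -/
theorem HasUp.of_main {m : ℕ} {l x X Y : ℤ} (hl : Odd l) (hx : IsTip (m + 1) x) (h1 : x < X)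
    (h2 : X + 1 < x + bF (m + 1)) (hY : Y = 3 * 2 ^ m * l ∨ Y = 3 * 2 ^ m * l - 1)
    (h : HasUp X Y) : 1 ≤ m ∧ (bF m : ℤ) ∣ X + 1 := by
  obtain ⟨m', t, hx', h3, h4⟩ := h
  have hlt : m' < m := by
    by_contra! hle
    have hd : (bF (m + 1) : ℤ) ∣ X + 1 :=
      dvd_trans (by exact_mod_cast bF_dvd_bF (by omega : m + 1 ≤ m' + 1)) hx'.corner_dvd
    have := eq_of_mem_block hx.dvd hd (by omega : x ≤ X + 1) h2 le_rfl (by omega)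
    omega
  obtain ⟨n, rfl⟩ : ∃ n, m = m' + 1 + n := Nat.exists_eq_add_of_le hlt
  have e : (3 : ℤ) * 2 ^ (m' + 1 + n) * l = 3 * 2 ^ m' * (2 * (2 ^ n * l)) := by
    rw [pow_add, pow_succ]; ring
  rw [e] at hY
  have hu : (0 : ℤ) < 3 * 2 ^ m' := by positivity
  have h5 : 4 * t + 1 ≤ 2 * (2 ^ n * l) := le_of_mul_le_mul_left (by omega) hu
  have h6 : 2 * (2 ^ n * l) ≤ 4 * t + 3 := le_of_mul_le_mul_left (by omega) hu
  have h7 : (2 : ℤ) ^ n * l = 2 ^ 0 * (2 * t + 1) := by omega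
  obtain rfl := two_pow_mul_odd hl ⟨t, rfl⟩ h7
  exact ⟨by omega, hx'.corner_dvd⟩

theorem IsTip.of_dvd {m : ℕ} {x X : ℤ} (hx : IsTip (m + 1) x) (h1 : x < X)
    (h2 : X < x + bF (m + 1)) (hd : (bF m : ℤ) ∣ X) : IsTip m (X - bF m) := by
  have hdx : (bF m : ℤ) ∣ x := dvd_trans (by exact_mod_cast bF_dvd_bF m.le_succ) hx.dvd
  obtain ⟨c, hc⟩ := dvd_sub hd hdx
  have hb : (0 : ℤ) < bF m := by exact_mod_cast bF_pos m
  have hc0 : 0 < c := pos_of_mul_pos_right (by rw [← hc]; omega) hb.le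
  have hc1 : c < 3 ^ m := by
    refine lt_of_mul_lt_mul_left (a := (bF m : ℤ)) ?_ hb.le
    rw [← hc]
    rw [bF_succ] at h2
    push_cast at h2
    linarith
  lift c to ℕ using hc0.le
  have h3 : 0 < 3 ^ m := by positivity
  have hc2 : c < 3 ^ m := by exact_mod_cast hc1
  have := IsTip.step m x c hx (by omega) (by unfold qF; omega)
  convert this using 1
  linarith

theorem HasUp.main {m : ℕ} {l x X Y : ℤ} (hl : Odd l) (hx : IsTip (m + 1) x) (h1 : x < X)
    (h2 : X + 1 < x + bF (m + 1)) (hY : Y = 3 * 2 ^ m * l ∨ Y = 3 * 2 ^ m * l - 1)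
    (hm : 1 ≤ m) (hd : (bF m : ℤ) ∣ X + 1) : HasUp X Y := by
  have htip := hx.of_dvd (by omega) h2 hd
  obtain ⟨n, rfl⟩ := Nat.exists_eq_add_of_le' hm
  obtain ⟨t, rfl⟩ := hl
  have hu : (0 : ℤ) < 2 ^ n := by positivity
  have e : (3 : ℤ) * 2 ^ (n + 1) * (2 * t + 1) = 3 * 2 ^ n * (4 * t + 2) := by
    rw [pow_succ]; ring
  rw [e] at hY
  refine ⟨n, t, htip, ?_, ?_⟩
  · have : (3 : ℤ) * 2 ^ n * (4 * t + 2) = 3 * 2 ^ n * (4 * t + 1) + 3 * 2 ^ n := by ring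
    omega
  · have : (3 : ℤ) * 2 ^ n * (4 * t + 3) = 3 * 2 ^ n * (4 * t + 2) + 3 * 2 ^ n := by ring
    omega

theorem neighbors_main {m : ℕ} {l x X : ℤ} (hl : Odd l) (hx : IsTip (m + 1) x) (h1 : x < X)
    (h2 : X + 1 < x + bF (m + 1)) (u : V) :
    s(((X, 3 * 2 ^ m * l) : V), u) ∈ xiEdges ↔
      u = (X + 1, 3 * 2 ^ m * l) ∨ u = (X - 1, 3 * 2 ^ m * l) ∨
        (1 ≤ m ∧ (bF m : ℤ) ∣ X + 1) ∧
          (u = (X, 3 * 2 ^ m * l + 1) ∨ u = (X, 3 * 2 ^ m * l - 1)) := by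
  have hr : HasRight X (3 * 2 ^ m * l) := (hasRight_iff hl hx h1.le (by omega)).2 (by omega)
  have hr' : HasRight (X - 1) (3 * 2 ^ m * l) :=
    (hasRight_iff hl hx (by omega) (by omega)).2 (by omega)
  have hu : HasUp X (3 * 2 ^ m * l) ↔ 1 ≤ m ∧ (bF m : ℤ) ∣ X + 1 :=
    ⟨HasUp.of_main hl hx h1 h2 (Or.inl rfl),
      fun h => HasUp.main hl hx h1 h2 (Or.inl rfl) h.1 h.2⟩
  have hu' : HasUp X (3 * 2 ^ m * l - 1) ↔ 1 ≤ m ∧ (bF m : ℤ) ∣ X + 1 :=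
    ⟨HasUp.of_main hl hx h1 h2 (Or.inr rfl),
      fun h => HasUp.main hl hx h1 h2 (Or.inr rfl) h.1 h.2⟩
  rw [mem_xiEdges_iff, hu, hu']
  tauto

/-- In the column of the corner of a branch, abutments belong to branches of the same order. -/
theorem hasUp_corner_iff {m : ℕ} {X Y : ℤ} (hX : IsTip (m + 1) (X + 1 - bF (m + 1))) :
    HasUp X Y ↔ ∃ t : ℤ, 3 * 2 ^ m * (4 * t + 1) ≤ Y ∧ Y < 3 * 2 ^ m * (4 * t + 3) := by
  constructor
  · rintro ⟨m', t, hx', h⟩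
    obtain rfl : m' = m := by
      have := hx'.order_unique (by omega) (by omega) hX
      omega
    exact ⟨t, h⟩
  · rintro ⟨t, h⟩
    exact ⟨m, t, hX, h⟩

theorem neighbors_corner {m : ℕ} {l X : ℤ} (hl : Odd l)
    (hX : IsTip (m + 1) (X + 1 - bF (m + 1))) (u : V) :
    s(((X, 3 * 2 ^ m * l) : V), u) ∈ xiEdges ↔
      u = (X, 3 * 2 ^ m * l + dirF l) ∨ u = (X - 1, 3 * 2 ^ m * l) := by
  have hb := four_le_bF (m + 1)
  have hr : ¬ HasRight X (3 * 2 ^ m * l) := by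
    rw [hasRight_iff hl hX (by omega) (by omega)]; omega
  have hr' : HasRight (X - 1) (3 * 2 ^ m * l) :=
    (hasRight_iff hl hX (by omega) (by omega)).2 (by omega)
  have hu0 : (0 : ℤ) < 3 * 2 ^ m := by positivity
  rw [mem_xiEdges_iff, hasUp_corner_iff hX, hasUp_corner_iff hX]
  rcases odd_cases hl with ⟨t, rfl⟩ | ⟨t, rfl⟩
  · have h1 : ∃ s : ℤ, 3 * 2 ^ m * (4 * s + 1) ≤ 3 * 2 ^ m * (4 * t + 1) ∧
        3 * 2 ^ m * (4 * t + 1) < 3 * 2 ^ m * (4 * s + 3) :=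
      ⟨t, le_rfl, (mul_lt_mul_iff_right₀ hu0).2 (by omega)⟩
    have h2 : ¬ ∃ s : ℤ, 3 * 2 ^ m * (4 * s + 1) ≤ 3 * 2 ^ m * (4 * t + 1) - 1 ∧
        3 * 2 ^ m * (4 * t + 1) - 1 < 3 * 2 ^ m * (4 * s + 3) := by
      rintro ⟨s, h3, h4⟩
      have h5 : 4 * s + 1 < 4 * t + 1 := lt_of_mul_lt_mul_left (by omega) hu0.le
      have h6 : 4 * t + 1 ≤ 4 * s + 3 := le_of_mul_le_mul_left (by omega) hu0
      omega
    rw [dirF_four_mul_add_one, or_comm (a := u = (X, _))]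
    simp only [hr, hr', h1, h2, and_true, and_false, false_or, or_false]
  · have h1 : ∃ s : ℤ, 3 * 2 ^ m * (4 * s + 1) ≤ 3 * 2 ^ m * (4 * t + 3) - 1 ∧
        3 * 2 ^ m * (4 * t + 3) - 1 < 3 * 2 ^ m * (4 * s + 3) := by
      have : 3 * 2 ^ m * (4 * t + 1) < 3 * 2 ^ m * (4 * t + 3) :=
        (mul_lt_mul_iff_right₀ hu0).2 (by omega)
      exact ⟨t, by omega, by omega⟩
    have h2 : ¬ ∃ s : ℤ, 3 * 2 ^ m * (4 * s + 1) ≤ 3 * 2 ^ m * (4 * t + 3) ∧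
        3 * 2 ^ m * (4 * t + 3) < 3 * 2 ^ m * (4 * s + 3) := by
      rintro ⟨s, h3, h4⟩
      have h5 : 4 * t + 3 < 4 * s + 3 := lt_of_mul_lt_mul_left h4 hu0.le
      have h6 : 4 * s + 1 ≤ 4 * t + 3 := le_of_mul_le_mul_left h3 hu0
      omega
    rw [dirF_four_mul_add_three, ← sub_eq_add_neg, or_comm (a := u = (X, _))]
    simp only [hr, hr', h1, h2, and_true, and_false, false_or]

theorem not_hasRight_abutment {m : ℕ} {X Y c : ℤ} (hX : IsTip (m + 1) (X + 1 - bF (m + 1)))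
    (h1 : 3 * 2 ^ m * c < Y) (h2 : Y < 3 * 2 ^ m * (c + 1)) :
    ¬ HasRight X Y ∧ ¬ HasRight (X - 1) Y := by
  have key : ∀ X', X' = X ∨ X' = X - 1 → ¬ HasRight X' Y := by
    rintro X' hX' ⟨m', l', x', hl', hx', hY, h3, h4⟩
    have hlt : m' < m := by
      by_contra! hle
      obtain ⟨n, rfl⟩ := Nat.exists_eq_add_of_le hle
      have hu0 : (0 : ℤ) < 3 * 2 ^ m := by positivity
      rw [show (3 : ℤ) * 2 ^ (m + n) * l' = 3 * 2 ^ m * (2 ^ n * l') by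
        rw [pow_add]; ring] at hY
      rw [hY] at h1 h2
      have h5 := lt_of_mul_lt_mul_left h1 hu0.le
      have h6 := lt_of_mul_lt_mul_left h2 hu0.le
      omega
    have hd : (bF (m' + 1) : ℤ) ∣ X + 1 :=
      dvd_trans (by exact_mod_cast bF_dvd_bF (by omega)) hX.corner_dvd
    have hc := eq_of_mem_block (x := X + 1 - bF (m' + 1)) (X := X) (dvd_sub hd dvd_rfl)
      hx'.dvd (by have := bF_pos (m' + 1); omega) (by omega) (by omega) (by omega)
    rw [hc] at hx'
    have := hx'.order_unique (by omega) (by omega) hX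
    omega
  exact ⟨key X (Or.inl rfl), key (X - 1) (Or.inr rfl)⟩

theorem neighbors_abutment {m : ℕ} {l X j : ℤ} (hl : Odd l)
    (hX : IsTip (m + 1) (X + 1 - bF (m + 1))) (h0 : 0 < j) (hj : j < 3 * 2 ^ m) (u : V) :
    s(((X, 3 * 2 ^ m * l + dirF l * j) : V), u) ∈ xiEdges ↔
      u = (X, 3 * 2 ^ m * l + dirF l * (j + 1)) ∨
        u = (X, 3 * 2 ^ m * l + dirF l * (j - 1)) := by
  have hu0 : (0 : ℤ) < 3 * 2 ^ m := by positivity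
  rw [mem_xiEdges_iff]
  rcases odd_cases hl with ⟨t, rfl⟩ | ⟨t, rfl⟩
  · rw [dirF_four_mul_add_one]
    simp only [one_mul]
    obtain ⟨hr, hr'⟩ := not_hasRight_abutment (c := 4 * t + 1)
      (Y := 3 * 2 ^ m * (4 * t + 1) + j) hX (by omega) (by linarith)
    have h3 : 3 * 2 ^ m * (4 * t + 3) = 3 * 2 ^ m * (4 * t + 1) + 2 * (3 * 2 ^ m : ℤ) := by
      ring
    have hu : HasUp X (3 * 2 ^ m * (4 * t + 1) + j) :=
      (hasUp_corner_iff hX).2 ⟨t, by omega, by omega⟩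
    have hu' : HasUp X (3 * 2 ^ m * (4 * t + 1) + j - 1) :=
      (hasUp_corner_iff hX).2 ⟨t, by omega, by omega⟩
    rw [← add_assoc, ← add_sub_assoc]
    tauto
  · rw [dirF_four_mul_add_three]
    obtain ⟨hr, hr'⟩ := not_hasRight_abutment (c := 4 * t + 2)
      (Y := 3 * 2 ^ m * (4 * t + 3) + -1 * j) hX (by linarith)
      (by rw [show 4 * t + 2 + 1 = 4 * t + 3 by ring]; linarith)
    have h3 : 3 * 2 ^ m * (4 * t + 3) = 3 * 2 ^ m * (4 * t + 1) + 2 * (3 * 2 ^ m : ℤ) := by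
      ring
    have hu : HasUp X (3 * 2 ^ m * (4 * t + 3) + -1 * j) :=
      (hasUp_corner_iff hX).2 ⟨t, by omega, by omega⟩
    have hu' : HasUp X (3 * 2 ^ m * (4 * t + 3) + -1 * j - 1) :=
      (hasUp_corner_iff hX).2 ⟨t, by omega, by omega⟩
    rw [show 3 * 2 ^ m * (4 * t + 3) + -1 * (j + 1) =
        3 * 2 ^ m * (4 * t + 3) + -1 * j - 1 by ring,
      show 3 * 2 ^ m * (4 * t + 3) + -1 * (j - 1) =
        3 * 2 ^ m * (4 * t + 3) + -1 * j + 1 by ring]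
    tauto

theorem stepWeight_right (β : ℝ) (X Y : ℤ) : stepWeight β (X, Y) (X + 1, Y) = β := by
  simp [stepWeight]

theorem stepWeight_of_fst_ne (β : ℝ) {v w : V} (h : w.1 ≠ v.1 + 1) : stepWeight β v w = 1 := by
  unfold stepWeight
  rw [if_neg]
  rintro rfl
  exact h rfl

/-- The walk on the fractal configuration hits `a` from `v` within expected time `c`. -/
abbrev XiHitLE (β : ℝ) (a v : V) (c : ℝ) : Prop :=
  HitLE (transProb β xiEdges) latticeStar a v c

theorem XiHitLE.of_one {β : ℝ} (hβ : 1 < β) {v r : V} {C : ℝ} (hF : ∀ u, s(v, u) ∈ xiEdges ↔ u = r)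
    (h : 1 ≤ C) : XiHitLE β r v C := by
  refine HitLE.of_neighbors hβ mem_latticeStar_of_mem_xiEdges (F := {r}) (by simpa using hF)
    (by simp) (fun _ => 0) (by simp) ?_
  have := stepWeight_pos (by linarith : 0 < β) v r
  simpa using by nlinarith

theorem XiHitLE.of_two {β : ℝ} (hβ : 1 < β) {v r w : V} {C d : ℝ}
    (hF : ∀ u, s(v, u) ∈ xiEdges ↔ u = r ∨ u = w) (hwr : w ≠ r) (hd : XiHitLE β v w d)
    (h : stepWeight β v r + stepWeight β v w + stepWeight β v w * d ≤ C * stepWeight β v r) :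
    XiHitLE β r v C := by
  refine HitLE.of_neighbors hβ mem_latticeStar_of_mem_xiEdges (F := {r, w})
    (by simpa using hF) (by simp) (fun _ => d) ?_ ?_
  · intro u hu hur
    obtain rfl : u = w := by simpa [hur] using hu
    exact hd
  · rw [Finset.sum_pair hwr.symm, Finset.erase_insert (by simpa using hwr.symm),
      Finset.sum_singleton]
    exact h

theorem XiHitLE.of_four {β : ℝ} (hβ : 1 < β) {v r w a b : V} {C d e : ℝ}
    (hF : ∀ u, s(v, u) ∈ xiEdges ↔ u = r ∨ u = w ∨ u = a ∨ u = b)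
    (hwr : w ≠ r) (har : a ≠ r) (hbr : b ≠ r) (haw : a ≠ w) (hbw : b ≠ w) (hab : a ≠ b)
    (hd : XiHitLE β v w d) (ha : XiHitLE β v a e) (hb : XiHitLE β v b e)
    (h : stepWeight β v r + stepWeight β v w + stepWeight β v a + stepWeight β v b +
      stepWeight β v w * d + stepWeight β v a * e + stepWeight β v b * e ≤
        C * stepWeight β v r) :
    XiHitLE β r v C := by
  refine HitLE.of_neighbors hβ mem_latticeStar_of_mem_xiEdges (F := {r, w, a, b})
    (by simpa using hF) (by simp) (fun u => if u = w then d else e) ?_ ?_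
  · intro u hu hur
    simp only [Finset.mem_insert, Finset.mem_singleton, hur, false_or] at hu
    rcases hu with rfl | rfl | rfl
    · simpa using hd
    · simpa [haw] using ha
    · simpa [hbw] using hb
  · rw [Finset.erase_insert (by simp [hwr.symm, har.symm, hbr.symm]),
      Finset.sum_insert (by simp [hwr.symm, har.symm, hbr.symm]),
      Finset.sum_insert (by simp [haw.symm, hbw.symm]), Finset.sum_pair hab,
      Finset.sum_insert (by simp [haw.symm, hbw.symm]), Finset.sum_pair hab]
    simp only [if_true, haw, hbw, if_false]
    linarith

/-- A walk entering an order-`k` branch from its root returns in expected time at most `T`. -/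
def BranchReturnLE (β : ℝ) (k : ℕ) (T : ℝ) : Prop :=
  ∀ l x : ℤ, Odd l → IsTip k x →
    XiHitLE β (x + bF k - 1, rowY k l + dirF l * (3 * 2 ^ (k - 1)))
      (x + bF k - 1, rowY k l + dirF l * (3 * 2 ^ (k - 1) - 1)) (T - 1)

theorem BranchReturnLE.hit_root {β : ℝ} {m : ℕ} {T : ℝ} (hT : 1 ≤ m → BranchReturnLE β m T)
    (hm : 1 ≤ m) {l X : ℤ} (hl : Odd l) (hX : IsTip m (X + 1 - bF m)) :
    XiHitLE β (X, 3 * 2 ^ m * l) (X, 3 * 2 ^ m * l + 1) (T - 1) ∧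
      XiHitLE β (X, 3 * 2 ^ m * l) (X, 3 * 2 ^ m * l - 1) (T - 1) := by
  obtain ⟨n, rfl⟩ := Nat.exists_eq_add_of_le' hm
  obtain ⟨t, rfl⟩ := hl
  have h1 := hT hm (4 * t + 3) _ ⟨2 * t + 1, by ring⟩ hX
  have h2 := hT hm (4 * t + 1) _ ⟨2 * t, by ring⟩ hX
  rw [dirF_four_mul_add_three, rowY_succ] at h1
  rw [dirF_four_mul_add_one, rowY_succ] at h2
  simp only [Nat.add_sub_cancel] at h1 h2
  constructor
  · convert h1 using 2 <;> ring
  · convert h2 using 2 <;> ring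

theorem XiHitLE.main_part {β : ℝ} (hβ : 1 < β) {m : ℕ} {T : ℝ} {E : ℕ → ℝ}
    (hT : 1 ≤ m → BranchReturnLE β m T)
    (hE₀ : 2 ≤ E 0)
    (hE : ∀ i, i + 3 ≤ bF (m + 1) →
      2 * β + E i + (if 1 ≤ m ∧ bF m ∣ i + 2 then 2 * T else 0) ≤ β * E (i + 1))
    {l x : ℤ} (hl : Odd l) (hx : IsTip (m + 1) x) (i : ℕ) (hi : i + 2 ≤ bF (m + 1)) :
    XiHitLE β (x + i + 1, 3 * 2 ^ m * l) (x + i, 3 * 2 ^ m * l) (E i - 1) := by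
  induction i with
  | zero =>
    simp only [Nat.cast_zero, add_zero]
    exact XiHitLE.of_one hβ (neighbors_tip hl hx) (by linarith)
  | succ i ih =>
    have ih := ih (by omega)
    have hstep := hE i (by omega)
    obtain ⟨X, hX⟩ : ∃ X : ℤ, X = x + (i + 1 : ℕ) := ⟨_, rfl⟩
    rw [show x + (i : ℤ) + 1 = X by rw [hX]; push_cast; ring,
      show x + (i : ℤ) = X - 1 by rw [hX]; push_cast; ring] at ih
    rw [← hX]
    have hX1 : x < X := by rw [hX]; omega
    have hX2 : X + 1 < x + bF (m + 1) := by rw [hX]; omega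
    have hn := neighbors_main hl hx hX1 hX2
    have hdiv : (bF m : ℤ) ∣ X + 1 ↔ bF m ∣ i + 2 := by
      have hdx : (bF m : ℤ) ∣ x := dvd_trans (by exact_mod_cast bF_dvd_bF m.le_succ) hx.dvd
      rw [show X + 1 = x + ((i + 2 : ℕ) : ℤ) by rw [hX]; push_cast; ring,
        Int.dvd_add_right hdx, Int.natCast_dvd_natCast]
    rw [hdiv] at hn
    by_cases hc : 1 ≤ m ∧ bF m ∣ i + 2
    · rw [if_pos hc] at hstep
      obtain ⟨ha, hb⟩ := BranchReturnLE.hit_root hT hc.1 hl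
        (hx.of_dvd (X := X + 1) (by omega) hX2 (hdiv.2 hc.2))
      simp only [hc, and_self, true_and] at hn
      refine XiHitLE.of_four hβ hn ?_ ?_ ?_ ?_ ?_ ?_ ih ha hb ?_
      any_goals simp
      any_goals omega
      rw [stepWeight_right, stepWeight_of_fst_ne, stepWeight_of_fst_ne, stepWeight_of_fst_ne]
      · linarith
      all_goals dsimp only; omega
    · rw [if_neg hc] at hstep
      simp only [hc, false_and, or_false] at hn
      refine XiHitLE.of_two hβ hn ?_ ih ?_
      · simp; omega
      · rw [stepWeight_right, stepWeight_of_fst_ne]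
        · linarith
        · dsimp only; omega

theorem BranchReturnLE.succ {β : ℝ} (hβ : 1 < β) {m : ℕ} {T : ℝ} {E : ℕ → ℝ}
    (hT : 1 ≤ m → BranchReturnLE β m T)
    (hE₀ : 2 ≤ E 0)
    (hE : ∀ i, i + 3 ≤ bF (m + 1) →
      2 * β + E i + (if 1 ≤ m ∧ bF m ∣ i + 2 then 2 * T else 0) ≤ β * E (i + 1)) :
    BranchReturnLE β (m + 1) (3 * 2 ^ (m + 1) + E (bF (m + 1) - 2)) := by
  intro l x hl hx
  have hb := four_le_bF (m + 1)
  have hd : dirF l = 1 ∨ dirF l = -1 := by unfold dirF; split_ifs <;> simp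
  have hmain := XiHitLE.main_part hβ hT hE₀ hE hl hx (bF (m + 1) - 2) (by omega)
  obtain ⟨X, hX⟩ : ∃ X : ℤ, X = x + bF (m + 1) - 1 := ⟨_, rfl⟩
  rw [show x + ((bF (m + 1) - 2 : ℕ) : ℤ) = X - 1 by omega, sub_add_cancel] at hmain
  have htip : IsTip (m + 1) (X + 1 - bF (m + 1)) := by rw [hX]; simpa using hx
  have habut : ∀ j : ℕ, j < 3 * 2 ^ m →
      XiHitLE β (X, 3 * 2 ^ m * l + dirF l * (j + 1)) (X, 3 * 2 ^ m * l + dirF l * j)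
        (E (bF (m + 1) - 2) + 1 + 2 * j) := by
    intro j hj
    induction j with
    | zero =>
      have hn := neighbors_corner hl htip
      simp only [Nat.cast_zero, zero_add, mul_zero, add_zero, mul_one]
      refine XiHitLE.of_two hβ hn ?_ hmain ?_
      · simp
      · rw [stepWeight_of_fst_ne, stepWeight_of_fst_ne]
        · linarith
        all_goals dsimp only; omega
    | succ j ih =>
      have ih := ih (by omega)
      have hn := neighbors_abutment (j := j + 1) hl htip (by positivity) (by exact_mod_cast hj)
      rw [add_sub_cancel_right] at hn
      push_cast
      refine XiHitLE.of_two hβ hn ?_ ih ?_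
      · rcases hd with h | h <;> rw [h] <;> simp <;> omega
      · rw [stepWeight_of_fst_ne, stepWeight_of_fst_ne]
        · linarith
        all_goals dsimp only; omega
  have hpos : 0 < 3 * 2 ^ m := by positivity
  have h := habut (3 * 2 ^ m - 1) (by omega)
  have hc : ((3 * 2 ^ m - 1 : ℕ) : ℤ) = 3 * 2 ^ m - 1 := by
    rw [Nat.cast_sub hpos]; push_cast; ring
  have hc' : ((3 * 2 ^ m - 1 : ℕ) : ℝ) = 3 * 2 ^ m - 1 := by
    rw [Nat.cast_sub hpos]; push_cast; ring
  rw [hc, hc', sub_add_cancel] at h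
  rw [rowY_succ, Nat.add_sub_cancel, ← hX]
  refine h.mono (le_of_eq ?_)
  rw [pow_succ]
  ring

/-- The partial sum `1 + β⁻¹ + ⋯ + β⁻⁽ⁿ⁻¹⁾`. -/
def geomSum (β : ℝ) (n : ℕ) : ℝ := ∑ i ∈ Finset.range n, (1 / β) ^ i

theorem mul_geomSum_succ {β : ℝ} (hβ : 0 < β) (n : ℕ) :
    β * geomSum β (n + 1) = β + geomSum β n := by
  unfold geomSum
  rw [Finset.sum_range_succ', mul_add, Finset.mul_sum, add_comm]
  congr 1
  · simp
  · refine Finset.sum_congr rfl fun i _ => ?_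
    rw [pow_succ]
    field_simp

theorem geomSum_mono {β : ℝ} (hβ : 0 < β) {m n : ℕ} (h : m ≤ n) :
    geomSum β m ≤ geomSum β n :=
  Finset.sum_le_sum_of_subset_of_nonneg (by simpa using h) fun i _ _ => by positivity

theorem one_le_geomSum {β : ℝ} (hβ : 0 < β) {n : ℕ} (h : 1 ≤ n) : 1 ≤ geomSum β n := by
  have := geomSum_mono hβ h
  simpa [geomSum] using this

theorem two_pow_le_bF {m : ℕ} (hm : 1 ≤ m) : 5 * 2 ^ (m + 1) ≤ 4 * bF m + 4 := by
  induction m, hm using Nat.le_induction with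
  | base => simp [bF]
  | succ m hm ih =>
    have h3 : 3 * bF m ≤ bF (m + 1) := by
      rw [bF_succ]
      exact Nat.mul_le_mul_right _ (Nat.le_self_pow (by omega) 3)
    have : 0 < 2 ^ m := by positivity
    have e1 : 2 ^ (m + 1) = 2 * 2 ^ m := by ring
    have e2 : 2 ^ (m + 1 + 1) = 4 * 2 ^ m := by ring
    rw [e1] at ih
    rw [e2]
    omega

/-- Weighted size of a branch of order `m + 1` (beyond its abutment), compared with the series
defining `Cprime`. -/
theorem branch_size_le {β : ℝ} (hβ : 1 < β) {m : ℕ} (hm : 1 ≤ m) :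
    2 * geomSum β (bF (m + 1) - 1) +
        (5 * 2 ^ (m + 1) - 4) * (geomSum β (bF (m + 1)) - geomSum β (bF m)) ≤
      ∑ i ∈ Finset.range (bF (m + 1)), 2 * (2 * (i : ℝ) + 1) * (1 / β) ^ i := by
  have hle : bF m ≤ bF (m + 1) := Nat.le_of_dvd (bF_pos _) (bF_dvd_bF m.le_succ)
  have h1 := geomSum_mono (by linarith : 0 < β) (Nat.sub_le (bF (m + 1)) 1)
  have h2 : ∑ i ∈ Finset.range (bF (m + 1)), 2 * (2 * (i : ℝ) + 1) * (1 / β) ^ i =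
      2 * geomSum β (bF (m + 1)) +
        ∑ i ∈ Finset.range (bF (m + 1)), 4 * (i : ℝ) * (1 / β) ^ i := by
    rw [geomSum, Finset.mul_sum, ← Finset.sum_add_distrib]
    exact Finset.sum_congr rfl fun i _ => by ring
  have h3 : geomSum β (bF (m + 1)) - geomSum β (bF m) =
      ∑ i ∈ Finset.Ico (bF m) (bF (m + 1)), (1 / β) ^ i := (Finset.sum_Ico_eq_sub _ hle).symm
  have h4 : (5 * 2 ^ (m + 1) - 4) * ∑ i ∈ Finset.Ico (bF m) (bF (m + 1)), (1 / β) ^ i ≤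
      ∑ i ∈ Finset.range (bF (m + 1)), 4 * (i : ℝ) * (1 / β) ^ i := by
    rw [Finset.mul_sum]
    refine (Finset.sum_le_sum fun i hi => ?_).trans
      (Finset.sum_le_sum_of_subset_of_nonneg (fun i hi => ?_) fun i _ _ => by positivity)
    · have hi' := (Finset.mem_Ico.1 hi).1
      have h5 : 5 * 2 ^ (m + 1) ≤ 4 * i + 4 := (two_pow_le_bF hm).trans (by omega)
      have h6 : (5 : ℝ) * 2 ^ (m + 1) ≤ 4 * i + 4 := by exact_mod_cast h5
      exact mul_le_mul_of_nonneg_right (by linarith) (by positivity)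
    · simpa using (Finset.mem_Ico.1 hi).2
  rw [h2, h3]
  linarith

theorem exists_branchReturnLE {β : ℝ} (hβ : 1 < β) (m : ℕ) :
    ∃ A : ℝ, BranchReturnLE β (m + 1) (3 * 2 ^ (m + 1) + A) ∧
      2 * (3 * 2 ^ (m + 1) + A) ≤ (5 * 2 ^ (m + 2) - 4) * geomSum β (bF (m + 1)) ∧
      A ≤ ∑ i ∈ Finset.range (bF (m + 1)), 2 * (2 * (i : ℝ) + 1) * (1 / β) ^ i := by
  have hβ0 : 0 < β := by linarith
  have hrec := mul_geomSum_succ hβ0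
  induction m with
  | zero =>
    have h1 := one_le_geomSum hβ0 (bF_pos 1)
    have h2 := geomSum_mono hβ0 (Nat.sub_le (bF 1) 1)
    refine ⟨2 * geomSum β (bF 1 - 2 + 1), BranchReturnLE.succ hβ (T := 0)
      (E := fun i => 2 * geomSum β (i + 1)) (by omega) ?_ ?_, ?_, ?_⟩
    · simp [geomSum]
    · intro i _
      have := hrec (i + 1)
      rw [if_neg (by omega)]
      linarith
    · rw [show bF 1 - 2 + 1 = bF 1 - 1 from rfl]
      norm_num
      linarith
    · rw [show bF 1 - 2 + 1 = bF 1 - 1 from rfl]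
      refine (mul_le_mul_of_nonneg_left h2 (by norm_num)).trans ?_
      rw [geomSum, Finset.mul_sum]
      refine Finset.sum_le_sum fun i _ => mul_le_mul_of_nonneg_right ?_ (by positivity)
      have : (0 : ℝ) ≤ i := by positivity
      linarith
  | succ m ih =>
    obtain ⟨A, hA, hA', -⟩ := ih
    have hb := four_le_bF (m + 1)
    have hb' := four_le_bF (m + 1 + 1)
    have hpow : (2 : ℝ) ≤ 2 ^ (m + 1) := by
      have := one_le_pow₀ (one_le_two : (1 : ℝ) ≤ 2) (n := m)
      rw [pow_succ]
      linarith
    set b := bF (m + 1) with hbdef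
    set Q : ℝ := 5 * 2 ^ (m + 2) - 4 with hQ
    have hlast : (bF (m + 1 + 1) - 2 + 1) % b + 1 = b := by
      obtain ⟨c, hc⟩ := bF_dvd_bF (Nat.le_succ (m + 1))
      rw [← hbdef] at hc
      have hc0 : c ≠ 0 := by rintro rfl; rw [hc] at hb'; omega
      obtain ⟨c, rfl⟩ := Nat.exists_eq_succ_of_ne_zero hc0
      have : bF (m + 1 + 1) - 2 + 1 = b - 1 + b * c := by
        rw [hc, Nat.mul_succ]; omega
      rw [this, Nat.add_mul_mod_self_left, Nat.mod_eq_of_lt (by omega)]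
      omega
    have hsucc := BranchReturnLE.succ hβ (m := m + 1) (T := 3 * 2 ^ (m + 1) + A)
      (E := fun i => 2 * geomSum β (i + 1) +
        Q * (geomSum β (i + 2) - geomSum β ((i + 1) % b + 1))) (fun _ => hA) ?_ ?_
    · refine ⟨_, hsucc, ?_, ?_⟩
      · rw [hlast, show bF (m + 1 + 1) - 2 + 2 = bF (m + 1 + 1) by omega,
          show bF (m + 1 + 1) - 2 + 1 = bF (m + 1 + 1) - 1 by omega]
        have h1 := one_le_geomSum hβ0 (by omega : 1 ≤ b)
        have h2 := geomSum_mono hβ0 (Nat.sub_le (bF (m + 1 + 1)) 1)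
        have e1 : (2 : ℝ) ^ (m + 1 + 1) = 2 * 2 ^ (m + 1) := by rw [pow_succ]; ring
        have e2 : (2 : ℝ) ^ (m + 1 + 2) = 4 * 2 ^ (m + 1) := by rw [pow_add]; ring
        have e3 : Q = 10 * 2 ^ (m + 1) - 4 := by rw [hQ, e1]; ring
        rw [e1, e2, e3]
        nlinarith [mul_nonneg (by linarith : (0 : ℝ) ≤ 10 * 2 ^ (m + 1) - 4)
          (by linarith : 0 ≤ geomSum β b - 1)]
      · rw [hlast, show bF (m + 1 + 1) - 2 + 2 = bF (m + 1 + 1) by omega,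
          show bF (m + 1 + 1) - 2 + 1 = bF (m + 1 + 1) - 1 by omega]
        exact branch_size_le hβ (by omega)
    · simp only [zero_add, Nat.mod_eq_of_lt (by omega : 1 < b)]
      simp [geomSum]
    · intro i _
      have r1 := hrec (i + 1)
      have r2 := hrec (i + 2)
      by_cases hd : b ∣ i + 2
      · rw [if_pos ⟨by omega, hd⟩]
        have h1 : (i + 1) % b + 1 = b := by
          have := Nat.mod_lt (i + 1) (by omega : 0 < b)
          have h0 := Nat.mod_eq_zero_of_dvd hd
          rw [show i + 2 = i + 1 + 1 by ring, Nat.add_mod,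
            Nat.mod_eq_of_lt (by omega : 1 < b)] at h0
          by_contra hne
          rw [Nat.mod_eq_of_lt (by omega)] at h0
          omega
        have h2 : (i + 1 + 1) % b + 1 = 1 := by rw [Nat.mod_eq_zero_of_dvd hd]
        have r3 := hrec 0
        have r4 : geomSum β 0 = 0 := by simp [geomSum]
        simp only [h1, h2]
        linear_combination hA' - 2 * r1 - Q * r2 + Q * r3 + Q * r4
      · rw [if_neg (by tauto)]
        have h1 : (i + 1 + 1) % b = (i + 1) % b + 1 := by
          rw [Nat.add_mod, Nat.mod_eq_of_lt (by omega : 1 < b)]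
          refine Nat.mod_eq_of_lt ?_
          have := Nat.mod_lt (i + 1) (by omega : 0 < b)
          refine lt_of_le_of_ne this fun he => hd ?_
          rw [Nat.dvd_iff_mod_eq_zero, show i + 2 = i + 1 + 1 by ring, Nat.add_mod,
            Nat.mod_eq_of_lt (by omega : 1 < b)]
          rw [he, Nat.mod_self]
        have r3 := hrec ((i + 1) % b + 1)
        simp only [h1]
        linear_combination - 2 * r1 - Q * r2 + Q * r3

theorem sum_le_Cprime {β : ℝ} (hβ : 1 < β) (n : ℕ) :
    ∑ i ∈ Finset.range n, 2 * (2 * (i : ℝ) + 1) * (1 / β) ^ i ≤ Cprime β := by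
  have hβ0 : 0 < β := by linarith
  have hlt : ‖1 / β‖ < 1 := by
    rw [Real.norm_of_nonneg (by positivity), div_lt_one hβ0]; exact hβ
  have hs : Summable fun i : ℕ => (2 * (i : ℝ) + 1) * (1 / β) ^ i := by
    have h1 := (summable_pow_mul_geometric_of_norm_lt_one 1 hlt).mul_left 2
    have h2 := summable_geometric_of_norm_lt_one hlt
    refine (h1.add h2).congr fun i => ?_
    ring
  have h := hs.sum_le_tsum (Finset.range n) fun i _ => by positivity
  have h0 : 0 ≤ ∑ i ∈ Finset.range n, (2 * (i : ℝ) + 1) * (1 / β) ^ i :=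
    Finset.sum_nonneg fun i _ => by positivity
  calc _ = 2 * ∑ i ∈ Finset.range n, (2 * (i : ℝ) + 1) * (1 / β) ^ i := by
        rw [Finset.mul_sum]
        exact Finset.sum_congr rfl fun i _ => by ring
    _ ≤ Cprime β := mul_le_mul (by linarith) h h0 (by linarith)

/-- Lemma 4.4 (b). A β-biased walk on ξ taking a step from the root of an order-`k` branch
into the branch (i.e. started at the abutment vertex adjacent to the root) returns to the
root in expected time at most `3·2^k + C'_β`. -/
theorem excursion_into_branch (β : ℝ) (hβ : 1 < β) (k : ℕ) (hk : 1 ≤ k)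
    (l x : ℤ) (hl : Odd l) (hx : IsTip k x) (μ : Measure (ℕ → V))
    (hμ : IsWalkLaw β xiEdges
      ((x + bF k - 1, rowY k l + dirF l * (3 * 2 ^ (k - 1) - 1)) : V) μ) :
    1 + ∫⁻ ω, (hitTime ω
        ((x + bF k - 1, rowY k l + dirF l * (3 * 2 ^ (k - 1))) : V) : ℝ≥0∞) ∂μ ≤
      ENNReal.ofReal (3 * 2 ^ k + Cprime β) := by
  obtain ⟨m, rfl⟩ := Nat.exists_eq_add_of_le' hk
  obtain ⟨A, hA, -, hA'⟩ := exists_branchReturnLE hβ m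
  have hhit := hA l x hl hx
  have hint := lintegral_hitTime_le hμ
    (isSubKernel_transProb hβ mem_latticeStar_of_mem_xiEdges)
    (transProb_eq_zero mem_latticeStar_of_mem_xiEdges) hhit
  calc _ ≤ 1 + ENNReal.ofReal (3 * 2 ^ (m + 1) + A - 1) := by gcongr
    _ = ENNReal.ofReal (3 * 2 ^ (m + 1) + A) := by
      rw [← ENNReal.ofReal_one, ← ENNReal.ofReal_add zero_le_one hhit.nonneg]
      congr 1
      ring
    _ ≤ _ := ENNReal.ofReal_le_ofReal (by linarith [hA'.trans (sum_le_Cprime hβ _)])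

end
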